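/- Let α > 0, let χ : ℝ → [0,1] be smooth with χ(s) = 1 for |s| < 1 and χ(s) = 0 for |s| > 2. Let T : ℝ³ → ℝ³ be measurable, let ω ∈ L¹(ℝ³) have compact support, and suppose |T(z)| ≤ L for a.e. z in the support of ω. For i ∈ {1,2,3} define G₁(x) = ∫_{ℝ³} ∂_{x_i}[ f_α(|x − T(z)|) (x − T(z))/|x − T(z)| ] (1 − χ(|x − T(z)|)) × (T₂(z), −T₁(z), 0) ω(z) dz and G₂(x) = ∫_{ℝ³} ∂_{x_i}[ f_α(|x − T(z)|) (x − T(z))/|x − T(z)| ] χ(|x − T(z)|) × (T₂(z), −T₁(z), 0) ω(z) dz. Then there is a constant C, depending only on α, L and χ, such that ‖G₁‖_{L^∞(ℝ³)} ≤ C ‖ω‖_{L¹(ℝ³)}, and for every 1 ≤ a < 3 there is a constant C_a, depending only on α, a, L and χ, such that ‖G₂‖_{L^a(ℝ³)} ≤ C_a ‖ω‖_{L¹(ℝ³)}. -/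

import Mathlib

open MeasureTheory

noncomputable section

abbrev E3 := EuclideanSpace ℝ (Fin 3)

/-- The kernel profile `f(z) = ((1+z)e^{-z} - 1)/(4 π z²)`. -/
def kf (z : ℝ) : ℝ := ((1 + z) * Real.exp (-z) - 1) / (4 * Real.pi * z ^ 2)

/-- The rescaled profile `f_α(r) = α⁻² f(r/α)`. -/
def kfa (α r : ℝ) : ℝ := (α ^ 2)⁻¹ * kf (r / α)

/-- The cross product on `ℝ³` (with the Euclidean norm). -/
def cross3 (a b : E3) : E3 :=
  (WithLp.equiv 2 (Fin 3 → ℝ)).symm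
    ![a 1 * b 2 - a 2 * b 1, a 2 * b 0 - a 0 * b 2, a 0 * b 1 - a 1 * b 0]

/-- The azimuthal vector `(w₂, -w₁, 0)` attached to `w ∈ ℝ³`. -/
def svec (w : E3) : E3 :=
  (WithLp.equiv 2 (Fin 3 → ℝ)).symm ![w 1, -(w 0), 0]

/-- The Biot–Savart-type kernel `Φ_α(v) = f_α(|v|) v/|v|` (equal to `0` at `v = 0`). -/
def PhiA (α : ℝ) (v : E3) : E3 := kfa α ‖v‖ • (‖v‖⁻¹ • v)

theorem norm_cross3_le (a b : E3) : ‖cross3 a b‖ ≤ ‖a‖ * ‖b‖ := by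
  refine abs_le_of_sq_le_sq' ?_ (by positivity) |>.2
  simp only [mul_pow, EuclideanSpace.norm_sq_eq, Fin.sum_univ_three, Real.norm_eq_abs, sq_abs]
  simp [cross3]
  nlinarith [sq_nonneg (a 0 * b 0 + a 1 * b 1 + a 2 * b 2)]

theorem norm_svec_le (w : E3) : ‖svec w‖ ≤ ‖w‖ := by
  refine abs_le_of_sq_le_sq' ?_ (by positivity) |>.2
  simp only [EuclideanSpace.norm_sq_eq, Fin.sum_univ_three, Real.norm_eq_abs, sq_abs]
  simp [svec]
  nlinarith [sq_nonneg (w 2)]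

theorem abs_one_add_mul_exp_neg_sub_one_le {z : ℝ} (hz : 0 ≤ z) :
    |(1 + z) * Real.exp (-z) - 1| ≤ z ^ 2 := by
  have h1 : 1 - z ≤ Real.exp (-z) := by linarith [Real.add_one_le_exp (-z)]
  have h2 : (1 + z) * Real.exp (-z) ≤ 1 := by
    rw [Real.exp_neg, ← div_eq_mul_inv, div_le_one (Real.exp_pos z)]
    linarith [Real.add_one_le_exp z]
  rw [abs_le]
  constructor <;> nlinarith

theorem PhiA_eq {α : ℝ} (hα : 0 < α) (v : E3) :
    PhiA α v = (((1 + ‖v‖ / α) * Real.exp (-(‖v‖ / α)) - 1) / (4 * Real.pi * ‖v‖ ^ 3)) • v := by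
  rcases eq_or_ne v 0 with rfl | hv
  · simp [PhiA]
  have hv' : ‖v‖ ≠ 0 := norm_ne_zero_iff.2 hv
  rw [PhiA, smul_smul, kfa, kf]
  congr 1
  field_simp

theorem norm_fderiv_PhiA_le {α : ℝ} (hα : 0 < α) {v : E3} (hv : v ≠ 0) :
    ‖fderiv ℝ (PhiA α) v‖ ≤ (α ^ 2)⁻¹ * ‖v‖⁻¹ := by
  set r := ‖v‖ with hr
  have hr0 : 0 < r := norm_pos_iff.2 hv
  have hπ := Real.pi_gt_three
  set h : ℝ := (1 + r / α) * Real.exp (-(r / α)) - 1 with hh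
  have hG : HasDerivAt
      (fun s : ℝ => ((1 + s / α) * Real.exp (-(s / α)) - 1) / (4 * Real.pi * s ^ 3))
      (-(r * Real.exp (-(r / α))) / (α ^ 2 * (4 * Real.pi * r ^ 3)) -
        3 * h / (4 * Real.pi * r ^ 4)) r := by
    have h1 : HasDerivAt (fun s : ℝ => s / α) (1 / α) r := (hasDerivAt_id r).div_const α
    have h2 := (((h1.const_add 1).mul h1.neg.exp).sub_const 1).div
      (((hasDerivAt_id r).pow 3).const_mul (4 * Real.pi)) (by simp; positivity)
    refine h2.congr_deriv ?_
    simp [hh]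
    field_simp
    ring
  have hn : HasFDerivAt (fun y : E3 => ‖y‖) (fderiv ℝ (fun y : E3 => ‖y‖) v) v :=
    ((contDiffAt_norm ℝ hv (n := 1)).differentiableAt (by simp)).hasFDerivAt
  have hnn : ‖fderiv ℝ (fun y : E3 => ‖y‖) v‖ ≤ 1 := by
    simpa using norm_fderiv_le_of_lipschitz ℝ (lipschitzWith_one_norm (E := E3)) (x₀ := v)
  have hΦ := (hG.comp_hasFDerivAt v hn).smul (hasFDerivAt_id v)
  have heq : PhiA α = fun y => _ := funext (PhiA_eq hα)
  rw [heq]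
  erw [hΦ.fderiv]
  have hhle : |h| ≤ (r / α) ^ 2 := abs_one_add_mul_exp_neg_sub_one_le (by positivity)
  have he : Real.exp (-(r / α)) ≤ 1 := Real.exp_le_one_iff.2 (by simp; positivity)
  have hA : |h / (4 * Real.pi * r ^ 3)| ≤ (α ^ 2)⁻¹ * r⁻¹ / (4 * Real.pi) := by
    rw [abs_div, abs_of_pos (by positivity : 0 < 4 * Real.pi * r ^ 3), div_le_iff₀ (by positivity)]
    refine hhle.trans (le_of_eq ?_)
    field_simp
  have hB : |(-(r * Real.exp (-(r / α))) / (α ^ 2 * (4 * Real.pi * r ^ 3)) -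
        3 * h / (4 * Real.pi * r ^ 4))| * r ≤ 4 * ((α ^ 2)⁻¹ * r⁻¹ / (4 * Real.pi)) := by
    have e : (-(r * Real.exp (-(r / α))) / (α ^ 2 * (4 * Real.pi * r ^ 3)) -
        3 * h / (4 * Real.pi * r ^ 4)) * r =
        -(Real.exp (-(r / α)) * ((α ^ 2)⁻¹ * r⁻¹ / (4 * Real.pi))) -
          3 * (h / (4 * Real.pi * r ^ 3)) := by
      field_simp
    rw [← abs_of_pos hr0, ← abs_mul, abs_of_pos hr0, e]
    have hp : 0 < (α ^ 2)⁻¹ * r⁻¹ / (4 * Real.pi) := by positivity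
    have hA' := abs_le.1 hA
    have := Real.exp_pos (-(r / α))
    rw [abs_le]
    constructor <;> nlinarith
  refine (norm_add_le _ _).trans ?_
  have h1 : ‖(((1 + ‖v‖ / α) * Real.exp (-(‖v‖ / α)) - 1) / (4 * Real.pi * ‖v‖ ^ 3)) •
      (ContinuousLinearMap.id ℝ E3)‖ ≤ (α ^ 2)⁻¹ * r⁻¹ / (4 * Real.pi) := by
    have := ContinuousLinearMap.norm_id_le (𝕜 := ℝ) (E := E3)
    rw [norm_smul]
    exact (mul_le_of_le_one_right (norm_nonneg _) this).trans hA
  refine (add_le_add h1 ?_ : _ ≤ (α ^ 2)⁻¹ * r⁻¹ / (4 * Real.pi) +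
    4 * ((α ^ 2)⁻¹ * r⁻¹ / (4 * Real.pi))).trans ?_
  · rw [ContinuousLinearMap.norm_smulRight_apply]
    refine le_trans ?_ hB
    refine mul_le_mul_of_nonneg_right ?_ hr0.le
    rw [norm_smul]
    exact mul_le_of_le_one_right (norm_nonneg _) hnn
  · have : 0 < (α ^ 2)⁻¹ * r⁻¹ := by positivity
    have e : (α ^ 2)⁻¹ * r⁻¹ / (4 * Real.pi) + 4 * ((α ^ 2)⁻¹ * r⁻¹ / (4 * Real.pi)) =
      (5 * ((α ^ 2)⁻¹ * r⁻¹)) / (4 * Real.pi) := by ring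
    rw [e, div_le_iff₀ (by positivity)]
    nlinarith

/-- Minkowski's integral inequality for a translated kernel. -/
theorem eLpNorm_lintegral_comp_sub_le (μ : Measure E3) [IsFiniteMeasure μ] {T : E3 → E3}
    (hT : Measurable T) {k : E3 → ENNReal} (hk : Measurable k) {a : ℝ} (ha : 1 ≤ a) :
    eLpNorm (fun x => ∫⁻ z, k (x - T z) ∂μ) (ENNReal.ofReal a) volume ≤
      eLpNorm k (ENNReal.ofReal a) volume * μ Set.univ := by
  have ha0 : 0 < a := by linarith
  have hkT : Measurable fun p : E3 × E3 => k (p.1 - T p.2) :=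
    hk.comp (measurable_fst.sub (hT.comp measurable_snd))
  have holder (x : E3) : (∫⁻ z, k (x - T z) ∂μ) ^ a ≤
      (∫⁻ z, k (x - T z) ^ a ∂μ) * μ Set.univ ^ (a - 1) := by
    have hm : Measurable fun z => k (x - T z) := hkT.comp measurable_prodMk_left
    have := eLpNorm'_le_eLpNorm'_mul_rpow_measure_univ zero_lt_one ha
      (hm.aestronglyMeasurable (μ := μ))
    simp only [eLpNorm'_eq_lintegral_enorm, enorm_eq_self, ENNReal.rpow_one, div_one] at this
    refine (ENNReal.rpow_le_rpow this ha0.le).trans (le_of_eq ?_)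
    rw [ENNReal.mul_rpow_of_nonneg _ _ ha0.le, ← ENNReal.rpow_mul, ← ENNReal.rpow_mul]
    congr 2
    · rw [one_div_mul_cancel ha0.ne', ENNReal.rpow_one]
    · field_simp
  rw [eLpNorm_eq_lintegral_rpow_enorm_toReal (by simpa using ha0) ENNReal.ofReal_ne_top,
    eLpNorm_eq_lintegral_rpow_enorm_toReal (by simpa using ha0) ENNReal.ofReal_ne_top,
    ENNReal.toReal_ofReal ha0.le]
  simp only [enorm_eq_self]
  have key : ∫⁻ x, (∫⁻ z, k (x - T z) ∂μ) ^ a ≤ (∫⁻ x, k x ^ a) * μ Set.univ ^ a := by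
    calc ∫⁻ x, (∫⁻ z, k (x - T z) ∂μ) ^ a
        ≤ ∫⁻ x, (∫⁻ z, k (x - T z) ^ a ∂μ) * μ Set.univ ^ (a - 1) := lintegral_mono holder
      _ = (∫⁻ x, ∫⁻ z, k (x - T z) ^ a ∂μ) * μ Set.univ ^ (a - 1) :=
          lintegral_mul_const _ (hkT.pow_const a).lintegral_prod_right'
      _ = (∫⁻ z, ∫⁻ x, k (x - T z) ^ a ∂volume ∂μ) * μ Set.univ ^ (a - 1) := by
          rw [lintegral_lintegral_swap (hkT.pow_const a).aemeasurable]
      _ = (∫⁻ x, k x ^ a) * μ Set.univ ^ a := by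
          simp_rw [lintegral_sub_right_eq_self (fun x => k x ^ a)]
          rw [lintegral_const, mul_assoc]
          congr 1
          conv_lhs => rw [← ENNReal.rpow_one (μ Set.univ), ← ENNReal.rpow_mul, one_mul,
            ← ENNReal.rpow_add_of_nonneg _ _ zero_le_one (by linarith)]
          congr 1
          ring
  refine (ENNReal.rpow_le_rpow key (by positivity)).trans (le_of_eq ?_)
  rw [ENNReal.mul_rpow_of_nonneg _ _ (by positivity), ← ENNReal.rpow_mul,
    mul_one_div_cancel ha0.ne', ENNReal.rpow_one]

/-- The singularity `|v|⁻¹`, localized to a ball of radius `3`. -/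
def localInvNorm : E3 → ENNReal := (Metric.ball 0 3).indicator fun v => ‖v‖ₑ⁻¹

theorem measurable_localInvNorm : Measurable localInvNorm :=
  measurable_enorm.inv.indicator measurableSet_ball

theorem eLpNorm_localInvNorm_lt_top {a : ℝ} (ha : 1 ≤ a) (ha3 : a < 3) :
    eLpNorm localInvNorm (ENNReal.ofReal a) volume < ⊤ := by
  have ha0 : 0 < a := by linarith
  rw [eLpNorm_lt_top_iff_lintegral_rpow_enorm_lt_top (by simpa using ha0) ENNReal.ofReal_ne_top,
    ENNReal.toReal_ofReal ha0.le]
  have hint : IntegrableOn (fun v : E3 => ‖v‖ ^ (-a)) (Metric.ball 0 3) :=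
    integrableOn_ball_of_norm_le_rpow (C := 1) (α := a) (by simp) (by simpa using ha3)
      (.of_forall fun v => by simp [abs_of_nonneg (Real.rpow_nonneg (norm_nonneg v) _)])
      (measurable_norm.pow_const _).aestronglyMeasurable
  refine lt_of_le_of_lt (le_of_eq ?_) hint.2
  rw [← lintegral_indicator measurableSet_ball]
  refine lintegral_congr_ae ?_
  filter_upwards [Measure.ae_ne volume (0 : E3)] with v hv
  by_cases hvb : v ∈ Metric.ball (0 : E3) 3
  · have hv' : 0 < ‖v‖ := norm_pos_iff.2 hv
    rw [localInvNorm, Set.indicator_of_mem hvb, Set.indicator_of_mem hvb, enorm_eq_self,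
      Real.rpow_neg hv'.le, enorm_inv (by positivity), ENNReal.inv_rpow,
      Real.enorm_rpow_of_nonneg hv'.le ha0.le, enorm_norm]
  · simp [localInvNorm, Set.indicator_of_notMem hvb, ha0]

theorem norm_cross3_fderiv_PhiA_le {α L : ℝ} (hα : 0 < α) {x w : E3} (hxw : x - w ≠ 0)
    (hw : ‖w‖ ≤ L) (i : Fin 3) :
    ‖cross3 (fderiv ℝ (fun y => PhiA α (y - w)) x (EuclideanSpace.single i 1)) (svec w)‖ ≤
      (α ^ 2)⁻¹ * L * ‖x - w‖⁻¹ := by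
  have h1 : ‖fderiv ℝ (PhiA α) (x - w) (EuclideanSpace.single i 1)‖ ≤
      (α ^ 2)⁻¹ * ‖x - w‖⁻¹ := by
    refine (ContinuousLinearMap.le_opNorm _ _).trans ?_
    simpa using norm_fderiv_PhiA_le hα hxw
  rw [fderiv_comp_sub]
  refine (norm_cross3_le _ _).trans ?_
  calc _ ≤ (α ^ 2)⁻¹ * ‖x - w‖⁻¹ * L :=
        mul_le_mul h1 ((norm_svec_le w).trans hw) (norm_nonneg _) (by positivity)
    _ = _ := by ring

theorem norm_integral_far_le {α L : ℝ} (hα : 0 < α) (hL : 0 < L) {χ : ℝ → ℝ}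
    (hχ01 : ∀ s, χ s ∈ Set.Icc (0 : ℝ) 1) (hχ1 : ∀ s : ℝ, |s| < 1 → χ s = 1)
    {T : E3 → E3} {ω : E3 → ℝ} (hω : Integrable ω)
    (hTL : ∀ᵐ z : E3, z ∈ Function.support ω → ‖T z‖ ≤ L) (i : Fin 3) (x : E3) :
    ‖∫ z : E3, ω z • ((1 - χ ‖x - T z‖) • cross3
        (fderiv ℝ (fun y => PhiA α (y - T z)) x (EuclideanSpace.single i 1)) (svec (T z)))‖ ≤
      (α ^ 2)⁻¹ * L * ∫ z, |ω z| := by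
  rw [← integral_const_mul]
  refine norm_integral_le_of_norm_le (hω.abs.const_mul _) ?_
  filter_upwards [hTL] with z hz
  rcases eq_or_ne (ω z) 0 with h0 | h0
  · simp [h0]
  rw [norm_smul, Real.norm_eq_abs, mul_comm]
  refine mul_le_mul_of_nonneg_right ?_ (abs_nonneg _)
  rcases lt_or_ge ‖x - T z‖ 1 with h | h
  · rw [hχ1 _ (by simpa using h)]
    simp
    positivity
  have hne : x - T z ≠ 0 := norm_pos_iff.1 (by linarith)
  have hc := hχ01 ‖x - T z‖
  rw [norm_smul, Real.norm_eq_abs, abs_of_nonneg (by linarith [hc.2])]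
  refine (mul_le_of_le_one_left (norm_nonneg _) (by linarith [hc.1])).trans ?_
  refine (norm_cross3_fderiv_PhiA_le hα hne (hz h0) i).trans ?_
  exact mul_le_of_le_one_right (by positivity) (inv_le_one_of_one_le₀ h)

theorem enorm_integral_near_le {α L : ℝ} (hα : 0 < α) (hL : 0 < L) {χ : ℝ → ℝ}
    (hχ01 : ∀ s, χ s ∈ Set.Icc (0 : ℝ) 1) (hχ0 : ∀ s : ℝ, 2 < |s| → χ s = 0)
    {T : E3 → E3} {ω : E3 → ℝ}
    (hTL : ∀ᵐ z : E3, z ∈ Function.support ω → ‖T z‖ ≤ L) (i : Fin 3) (x : E3) :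
    ‖∫ z : E3, ω z • (χ ‖x - T z‖ • cross3
        (fderiv ℝ (fun y => PhiA α (y - T z)) x (EuclideanSpace.single i 1)) (svec (T z)))‖ₑ ≤
      ENNReal.ofReal ((α ^ 2)⁻¹ * L) * ∫⁻ z, ‖ω z‖ₑ * localInvNorm (x - T z) := by
  rw [← lintegral_const_mul' _ _ ENNReal.ofReal_ne_top]
  refine (enorm_integral_le_lintegral_enorm _).trans (lintegral_mono_ae ?_)
  filter_upwards [hTL] with z hz
  rcases eq_or_ne (ω z) 0 with h0 | h0
  · simp [h0]
  rw [enorm_smul, mul_left_comm]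
  gcongr
  by_cases hb : x - T z ∈ Metric.ball (0 : E3) 3
  · rw [localInvNorm, Set.indicator_of_mem hb]
    rcases eq_or_ne (x - T z) 0 with he | hne
    · have hc : ENNReal.ofReal ((α ^ 2)⁻¹ * L) ≠ 0 := by
        rw [Ne, ENNReal.ofReal_eq_zero, not_le]
        positivity
      rw [he, enorm_zero, ENNReal.inv_zero, ENNReal.mul_top hc]
      exact le_top
    have hc := hχ01 ‖x - T z‖
    rw [← ofReal_norm, ← ofReal_norm (x - T z), ← ENNReal.ofReal_inv_of_pos (norm_pos_iff.2 hne),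
      ← ENNReal.ofReal_mul (by positivity)]
    refine ENNReal.ofReal_le_ofReal ?_
    rw [norm_smul, Real.norm_eq_abs, abs_of_nonneg hc.1]
    exact (mul_le_of_le_one_left (norm_nonneg _) hc.2).trans
      (norm_cross3_fderiv_PhiA_le hα hne (hz h0) i)
  · rw [hχ0 _ (by
      rw [abs_norm]
      have := not_lt.1 (mt mem_ball_zero_iff.2 hb)
      linarith)]
    simp

/-- Far/near decomposition of the gradient of the velocity: the far part `G₁`
(cutoff `1 - χ`) is bounded by `C ‖ω‖_{L¹}`, and the near part `G₂` (cutoff `χ`)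
has `L^a` norm at most `C_a ‖ω‖_{L¹}` for every `1 ≤ a < 3`. -/
theorem grad_velocity_decomposition (α L : ℝ) (hα : 0 < α) (hL : 0 < L)
    (χ : ℝ → ℝ) (hχ : ContDiff ℝ (⊤ : ℕ∞) χ) (hχ01 : ∀ s, χ s ∈ Set.Icc (0 : ℝ) 1)
    (hχ1 : ∀ s : ℝ, |s| < 1 → χ s = 1) (hχ0 : ∀ s : ℝ, 2 < |s| → χ s = 0) :
    (∃ C : ℝ, 0 < C ∧
      ∀ (T : E3 → E3), Measurable T →
        ∀ ω : E3 → ℝ, Integrable ω → HasCompactSupport ω →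
          (∀ᵐ z : E3, z ∈ Function.support ω → ‖T z‖ ≤ L) →
          ∀ (i : Fin 3) (x : E3),
            ‖∫ z : E3, ω z •
                ((1 - χ ‖x - T z‖) •
                  cross3
                    (fderiv ℝ (fun y => PhiA α (y - T z)) x (EuclideanSpace.single i 1))
                    (svec (T z)))‖ ≤ C * ∫ z : E3, |ω z|) ∧
    ∀ a : ℝ, 1 ≤ a → a < 3 →
      ∃ Ca : ℝ, 0 < Ca ∧
        ∀ (T : E3 → E3), Measurable T →
          ∀ ω : E3 → ℝ, Integrable ω → HasCompactSupport ω →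
            (∀ᵐ z : E3, z ∈ Function.support ω → ‖T z‖ ≤ L) →
            ∀ i : Fin 3,
              eLpNorm
                (fun x : E3 => ∫ z : E3, ω z •
                  (χ ‖x - T z‖ •
                    cross3
                      (fderiv ℝ (fun y => PhiA α (y - T z)) x (EuclideanSpace.single i 1))
                      (svec (T z))))
                (ENNReal.ofReal a) volume ≤
              ENNReal.ofReal (Ca * ∫ z : E3, |ω z|) := by
  refine ⟨⟨(α ^ 2)⁻¹ * L, by positivity, fun T _ ω hω _ hTL i x =>
    norm_integral_far_le hα hL hχ01 hχ1 hω hTL i x⟩, fun a ha ha3 => ?_⟩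
  set N := eLpNorm localInvNorm (ENNReal.ofReal a) volume with hN
  have hNtop : N ≠ ⊤ := (eLpNorm_localInvNorm_lt_top ha ha3).ne
  refine ⟨(α ^ 2)⁻¹ * L * (N.toReal + 1), by positivity, fun T hT ω hω _ hTL i => ?_⟩
  have hωm : AEMeasurable (fun z => ‖ω z‖ₑ) := hω.aestronglyMeasurable.enorm
  set μ : Measure E3 := volume.withDensity fun z => ‖ω z‖ₑ with hμ
  have hμuniv : μ Set.univ = ENNReal.ofReal (∫ z, |ω z|) := by
    rw [hμ, withDensity_apply _ MeasurableSet.univ, Measure.restrict_univ]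
    simpa using (ofReal_integral_norm_eq_lintegral_enorm hω).symm
  have : IsFiniteMeasure μ := ⟨by simp [hμuniv]⟩
  have hpt (x : E3) : ∫⁻ z, ‖ω z‖ₑ * localInvNorm (x - T z) =
      ∫⁻ z, localInvNorm (x - T z) ∂μ :=
    (lintegral_withDensity_eq_lintegral_mul₀ hωm
      (measurable_localInvNorm.comp (measurable_const.sub hT)).aemeasurable).symm
  calc _ ≤ ((α ^ 2)⁻¹ * L).toNNReal •
        eLpNorm (fun x => ∫⁻ z, localInvNorm (x - T z) ∂μ) (ENNReal.ofReal a) volume := by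
        refine eLpNorm_le_nnreal_smul_eLpNorm_of_ae_le_mul' (.of_forall fun x => ?_) _
        rw [enorm_eq_self, ← hpt]
        exact enorm_integral_near_le hα hL hχ01 hχ0 hTL i x
    _ ≤ ENNReal.ofReal ((α ^ 2)⁻¹ * L) * (N * μ Set.univ) := by
        rw [ENNReal.smul_def, smul_eq_mul]
        exact mul_le_mul_right (eLpNorm_lintegral_comp_sub_le μ hT measurable_localInvNorm ha) _
    _ ≤ _ := by
        rw [hμuniv, ENNReal.ofReal_mul (p := (α ^ 2)⁻¹ * L * (N.toReal + 1)) (by positivity),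
          ENNReal.ofReal_mul (p := (α ^ 2)⁻¹ * L) (by positivity), mul_assoc]
        have hN1 : N ≤ ENNReal.ofReal (N.toReal + 1) :=
          (ENNReal.ofReal_toReal hNtop).symm.le.trans (ENNReal.ofReal_le_ofReal (by linarith))
        gcongr

end
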